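/- arXiv:1511.01787 — 3 statements merged into one kernel-verified Lean document; each statement's English description precedes it below -/
import Mathlib

section
/- For every natural number n ≥ 1, the function y(ζ) = √(ζ² + 4)·F_n(ζ) satisfies the Lucas-type ordinary differential equation (4 + ζ²)·y''(ζ) + ζ·y'(ζ) − n²·y(ζ) = 0 for all real ζ; that is, it is a second solution of the equation satisfied by the Lucas polynomials. -/
lemma hasDerivAt_sqrt_sq_add_four (s : ℝ) :
    HasDerivAt (fun s : ℝ => √(s ^ 2 + 4)) (s / √(s ^ 2 + 4)) s := by
  have hs : HasDerivAt (fun s : ℝ => s ^ 2 + 4) (2 * s) s := by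
    simpa using (hasDerivAt_pow 2 s).add_const (4 : ℝ)
  convert hs.sqrt (by positivity) using 1
  rw [mul_div_mul_left _ _ two_ne_zero]

/-- The combinations `αⁿ + c βⁿ` of powers of the roots `α, β` of `X² = sX + 1`,
differentiated in `s`. -/
lemma hasDerivAt_pow_roots (n : ℕ) (c s : ℝ) :
    HasDerivAt (fun s : ℝ => ((s + √(s ^ 2 + 4)) / 2) ^ n + c * ((s - √(s ^ 2 + 4)) / 2) ^ n)
      (n * (((s + √(s ^ 2 + 4)) / 2) ^ n + -c * ((s - √(s ^ 2 + 4)) / 2) ^ n)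
        / √(s ^ 2 + 4)) s := by
  have hr := hasDerivAt_sqrt_sq_add_four s
  have hpos : 0 < √(s ^ 2 + 4) := by positivity
  have ha := (((hasDerivAt_id' s).add hr).div_const 2).pow n
  have hb := ((((hasDerivAt_id' s).sub hr).div_const 2).pow n).const_mul c
  refine (ha.add hb).congr_deriv ?_
  rcases n with _ | n
  · simp
  · simp only [Nat.add_sub_cancel, Pi.add_apply, Pi.sub_apply]
    field_simp
    ring

/-- Binet's formula for the Fibonacci polynomials. -/
lemma sqrt_mul_fib_eq (F : ℕ → ℝ → ℝ)
    (h1 : ∀ ζ : ℝ, F 1 ζ = 1)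
    (h2 : ∀ ζ : ℝ, F 2 ζ = ζ)
    (hrec : ∀ n : ℕ, 1 ≤ n → ∀ ζ : ℝ, F (n + 2) ζ = ζ * F (n + 1) ζ + F n ζ)
    (n : ℕ) (hn : 1 ≤ n) (s : ℝ) :
    √(s ^ 2 + 4) * F n s
      = ((s + √(s ^ 2 + 4)) / 2) ^ n + -1 * ((s - √(s ^ 2 + 4)) / 2) ^ n := by
  have hsq : √(s ^ 2 + 4) ^ 2 = s ^ 2 + 4 := Real.sq_sqrt (by positivity)
  set r := √(s ^ 2 + 4)
  induction n using Nat.twoStepInduction with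
  | zero => omega
  | one => rw [h1]; ring
  | more n ih ih' =>
    rcases Nat.eq_zero_or_pos n with rfl | hpos
    · rw [h2]; ring
    · have hα : ((s + r) / 2) ^ 2 = s * ((s + r) / 2) + 1 := by linear_combination hsq / 4
      have hβ : ((s - r) / 2) ^ 2 = s * ((s - r) / 2) + 1 := by linear_combination hsq / 4
      rw [hrec n hpos]
      linear_combination s * ih' (by omega) + ih hpos - ((s + r) / 2) ^ n * hα
        + ((s - r) / 2) ^ n * hβ

/-- For every natural number `n ≥ 1`, the function
`y(ζ) = √(ζ² + 4)·F_n(ζ)` satisfies the Lucas-type ODE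
`(4 + ζ²)·y''(ζ) + ζ·y'(ζ) − n²·y(ζ) = 0` for all real `ζ`, where `F_n` are the
Fibonacci polynomial functions. -/
theorem sqrt_mul_fib_lucas_ode (F : ℕ → ℝ → ℝ)
    (h1 : ∀ ζ : ℝ, F 1 ζ = 1)
    (h2 : ∀ ζ : ℝ, F 2 ζ = ζ)
    (hrec : ∀ n : ℕ, 1 ≤ n → ∀ ζ : ℝ, F (n + 2) ζ = ζ * F (n + 1) ζ + F n ζ) :
    ∀ n : ℕ, 1 ≤ n → ∀ ζ : ℝ,
      (4 + ζ ^ 2) * deriv (deriv (fun s : ℝ => Real.sqrt (s ^ 2 + 4) * F n s)) ζ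
        + ζ * deriv (fun s : ℝ => Real.sqrt (s ^ 2 + 4) * F n s) ζ
        - (n : ℝ) ^ 2 * (Real.sqrt (ζ ^ 2 + 4) * F n ζ) = 0 := by
  intro n hn ζ
  have hy : (fun s : ℝ => √(s ^ 2 + 4) * F n s) = fun s : ℝ =>
      ((s + √(s ^ 2 + 4)) / 2) ^ n + -1 * ((s - √(s ^ 2 + 4)) / 2) ^ n :=
    funext fun s => sqrt_mul_fib_eq F h1 h2 hrec n hn s
  have hy' : deriv (fun s : ℝ => √(s ^ 2 + 4) * F n s) = fun s : ℝ =>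
      n * (((s + √(s ^ 2 + 4)) / 2) ^ n + 1 * ((s - √(s ^ 2 + 4)) / 2) ^ n)
        / √(s ^ 2 + 4) := by
    rw [hy]
    funext s
    simpa only [neg_neg] using (hasDerivAt_pow_roots n (-1) s).deriv
  have hpos : 0 < √(ζ ^ 2 + 4) := by positivity
  have hsq : √(ζ ^ 2 + 4) ^ 2 = ζ ^ 2 + 4 := Real.sq_sqrt (by positivity)
  have hy'' := (((hasDerivAt_pow_roots n 1 ζ).const_mul (n : ℝ)).fun_div
    (hasDerivAt_sqrt_sq_add_four ζ) hpos.ne').deriv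
  rw [hy', sqrt_mul_fib_eq F h1 h2 hrec n hn ζ, hy'',
    add_comm 4 (ζ ^ 2), ← hsq, Real.sqrt_sq hpos.le]
  field_simp
  ring
end

section
/- For every natural number n ≥ 1, the function y(η) = H_n(η)/√(1 + 4η) satisfies, for all real η with 1 + 4η > 0, the ordinary differential equation η(1 + 4η)·y''(η) − [(n − 1) + 2(2n − 5)η]·y'(η) + (n − 1)(n − 2)·y(η) = 0; that is, it is a second linearly independent solution of the equation satisfied by the single-variable Fibonacci functions. -/
theorem hasDerivAt_sqrt_one_add_four_mul {t : ℝ} (ht : 0 < 1 + 4 * t) :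
    HasDerivAt (fun t : ℝ => √(1 + 4 * t)) (2 / √(1 + 4 * t)) t := by
  have h : HasDerivAt (fun t : ℝ => 1 + 4 * t) 4 t := by
    simpa using ((hasDerivAt_id t).const_mul 4).const_add 1
  convert h.sqrt ht.ne' using 1
  ring

/-- Binet's formula for the single-variable Lucas functions. -/
theorem lucas_eq_binet (H : ℕ → ℝ → ℝ)
    (h1 : ∀ η : ℝ, H 1 η = 1)
    (h2 : ∀ η : ℝ, H 2 η = 1 + 2 * η)
    (hrec : ∀ n : ℕ, 1 ≤ n → ∀ η : ℝ, H (n + 2) η = H (n + 1) η + η * H n η)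
    {t : ℝ} (ht : 0 < 1 + 4 * t) (k : ℕ) :
    H (k + 1) t = ((1 + √(1 + 4 * t)) / 2) ^ (k + 1) + ((1 - √(1 + 4 * t)) / 2) ^ (k + 1) := by
  have hs : √(1 + 4 * t) ^ 2 = 1 + 4 * t := Real.sq_sqrt ht.le
  generalize √(1 + 4 * t) = s at hs
  obtain rfl : t = (s ^ 2 - 1) / 4 := by linarith
  induction k using Nat.twoStepInduction with
  | zero => rw [h1]; ring
  | one => rw [h2]; ring
  | more k ih₀ ih₁ => rw [hrec (k + 1) (by omega), ih₀, ih₁]; ring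

theorem hasDerivAt_binet_div_sqrt {t : ℝ} (ht : 0 < 1 + 4 * t) (k : ℕ) :
    HasDerivAt
      (fun t : ℝ => (((1 + √(1 + 4 * t)) / 2) ^ (k + 1) + ((1 - √(1 + 4 * t)) / 2) ^ (k + 1))
        / √(1 + 4 * t))
      ((k + 1) * (((1 + √(1 + 4 * t)) / 2) ^ k - ((1 - √(1 + 4 * t)) / 2) ^ k)
          / √(1 + 4 * t) ^ 2
        - 2 * (((1 + √(1 + 4 * t)) / 2) ^ (k + 1) + ((1 - √(1 + 4 * t)) / 2) ^ (k + 1))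
          / √(1 + 4 * t) ^ 3) t := by
  have hd := hasDerivAt_sqrt_one_add_four_mul ht
  have hs : √(1 + 4 * t) ≠ 0 := (Real.sqrt_pos.2 ht).ne'
  refine (((((hd.const_add 1).div_const 2).fun_pow (k + 1)).fun_add
    (((hd.const_sub 1).div_const 2).fun_pow (k + 1))).fun_div hd hs).congr_deriv ?_
  simp only [Nat.add_sub_cancel]
  push_cast
  field_simp
  ring

theorem hasDerivAt_deriv_binet_div_sqrt {t : ℝ} (ht : 0 < 1 + 4 * t) (k : ℕ) :
    HasDerivAt
      (fun t : ℝ => (k + 1) * (((1 + √(1 + 4 * t)) / 2) ^ k - ((1 - √(1 + 4 * t)) / 2) ^ k)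
          / √(1 + 4 * t) ^ 2
        - 2 * (((1 + √(1 + 4 * t)) / 2) ^ (k + 1) + ((1 - √(1 + 4 * t)) / 2) ^ (k + 1))
          / √(1 + 4 * t) ^ 3)
      (k * (k + 1) * (((1 + √(1 + 4 * t)) / 2) ^ (k - 1) + ((1 - √(1 + 4 * t)) / 2) ^ (k - 1))
          / √(1 + 4 * t) ^ 3
        - 6 * (k + 1) * (((1 + √(1 + 4 * t)) / 2) ^ k - ((1 - √(1 + 4 * t)) / 2) ^ k)
          / √(1 + 4 * t) ^ 4
        + 12 * (((1 + √(1 + 4 * t)) / 2) ^ (k + 1) + ((1 - √(1 + 4 * t)) / 2) ^ (k + 1))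
          / √(1 + 4 * t) ^ 5) t := by
  have hd := hasDerivAt_sqrt_one_add_four_mul ht
  have hs : √(1 + 4 * t) ≠ 0 := (Real.sqrt_pos.2 ht).ne'
  have ha := (hd.const_add 1).div_const 2
  have hb := (hd.const_sub 1).div_const 2
  refine (((((ha.fun_pow k).fun_sub (hb.fun_pow k)).const_mul ((k : ℝ) + 1)).fun_div
    (hd.fun_pow 2) (pow_ne_zero 2 hs)).fun_sub
    ((((ha.fun_pow (k + 1)).fun_add (hb.fun_pow (k + 1))).const_mul 2).fun_div
    (hd.fun_pow 3) (pow_ne_zero 3 hs))).congr_deriv ?_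
  simp only [Nat.add_sub_cancel]
  push_cast
  generalize ((1 + √(1 + 4 * t)) / 2) ^ (k - 1) = A
  generalize ((1 - √(1 + 4 * t)) / 2) ^ (k - 1) = B
  field_simp
  ring

/-- For every natural number `n ≥ 1`, the function
`y(η) = H_n(η)/√(1 + 4η)` satisfies, for all real `η` with `1 + 4η > 0`, the ODE
`η(1 + 4η)·y''(η) − [(n − 1) + 2(2n − 5)η]·y'(η) + (n − 1)(n − 2)·y(η) = 0`,
where `H_n` are the single-variable Lucas functions. -/
theorem lucas_over_sqrt_single_var_fib_ode (H : ℕ → ℝ → ℝ)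
    (h1 : ∀ η : ℝ, H 1 η = 1)
    (h2 : ∀ η : ℝ, H 2 η = 1 + 2 * η)
    (hrec : ∀ n : ℕ, 1 ≤ n → ∀ η : ℝ, H (n + 2) η = H (n + 1) η + η * H n η) :
    ∀ n : ℕ, 1 ≤ n → ∀ η : ℝ, 1 + 4 * η > 0 →
      η * (1 + 4 * η) * deriv (deriv (fun s : ℝ => H n s / Real.sqrt (1 + 4 * s))) η
        - (((n : ℝ) - 1) + 2 * (2 * (n : ℝ) - 5) * η)
            * deriv (fun s : ℝ => H n s / Real.sqrt (1 + 4 * s)) η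
        + ((n : ℝ) - 1) * ((n : ℝ) - 2) * (H n η / Real.sqrt (1 + 4 * η)) = 0 := by
  intro n hn η hη
  obtain ⟨k, rfl⟩ : ∃ k, n = k + 1 := ⟨n - 1, by omega⟩
  have hpos : ∀ t : ℝ, 0 < 1 + 4 * t → ∀ᶠ u : ℝ in nhds t, 0 < 1 + 4 * u := fun t ht =>
    (by fun_prop : Continuous fun t : ℝ => 1 + 4 * t).continuousAt.eventually_const_lt ht
  have hderiv : ∀ t : ℝ, 0 < 1 + 4 * t → deriv (fun s : ℝ => H (k + 1) s / √(1 + 4 * s)) t = _ :=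
    fun t ht => ((hasDerivAt_binet_div_sqrt ht k).congr_of_eventuallyEq (by
      filter_upwards [hpos t ht] with u hu
      rw [lucas_eq_binet H h1 h2 hrec hu])).deriv
  have hderiv₂ : deriv (deriv (fun s : ℝ => H (k + 1) s / √(1 + 4 * s))) η = _ :=
    ((hasDerivAt_deriv_binet_div_sqrt hη k).congr_of_eventuallyEq
      ((hpos η hη).mono fun t ht => hderiv t ht)).deriv
  rw [hderiv₂, hderiv η hη, lucas_eq_binet H h1 h2 hrec hη]
  have hs : √(1 + 4 * η) ^ 2 = 1 + 4 * η := Real.sq_sqrt (le_of_lt hη)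
  have hs₀ : √(1 + 4 * η) ≠ 0 := (Real.sqrt_pos.2 hη).ne'
  generalize √(1 + 4 * η) = s at hs hs₀
  obtain rfl : η = (s ^ 2 - 1) / 4 := by linarith
  rcases k with _ | m
  · field_simp
    push_cast
    ring
  · simp only [Nat.add_sub_cancel, pow_succ ((1 + s) / 2), pow_succ ((1 - s) / 2)]
    generalize ((1 + s) / 2) ^ m = A
    generalize ((1 - s) / 2) ^ m = B
    push_cast
    field_simp
    ring
end

section
/- For every real parameter μ, the function y(ζ) = cosh(μ·arsinh(ζ/2))/√(ζ² + 4) satisfies the Fibonacci-type auxiliary ordinary differential equation (4 + ζ²)·y''(ζ) + 3ζ·y'(ζ) − (μ² − 1)·y(ζ) = 0 for all real ζ. -/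
/-- The derivative of `arsinh (x / 2)` is `1 / √(x² + 4)`. -/
theorem hasDerivAt_arsinh_half (x : ℝ) :
    HasDerivAt (fun s : ℝ => Real.arsinh (s / 2)) (1 / √(x ^ 2 + 4)) x := by
  have h := ((hasDerivAt_id x).div_const 2).arsinh
  refine h.congr_deriv ?_
  have h4 : √(x ^ 2 + 4) = 2 * √(1 + (x / 2) ^ 2) := by
    rw [show x ^ 2 + 4 = 2 ^ 2 * (1 + (x / 2) ^ 2) by ring, Real.sqrt_mul (by positivity),
      Real.sqrt_sq (by norm_num)]
  have hpos : 0 < √(1 + (x / 2) ^ 2) := Real.sqrt_pos.2 (by positivity)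
  simp only [id, smul_eq_mul]
  rw [h4]
  field_simp

/-- First-order relation `(x² + 4) y' = μ sinh (μ arsinh (x / 2)) - x y` for
`y = cosh (μ arsinh (x / 2)) / √(x² + 4)`. -/
theorem hasDerivAt_cosh_arsinh_div_sqrt (μ x : ℝ) :
    HasDerivAt (fun s : ℝ => Real.cosh (μ * Real.arsinh (s / 2)) / √(s ^ 2 + 4))
      ((μ * Real.sinh (μ * Real.arsinh (x / 2))
        - x * (Real.cosh (μ * Real.arsinh (x / 2)) / √(x ^ 2 + 4))) / (x ^ 2 + 4)) x := by
  have hx : 0 < x ^ 2 + 4 := by positivity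
  have hw : 0 < √(x ^ 2 + 4) := Real.sqrt_pos.2 hx
  have hd := (((hasDerivAt_pow 2 x).add_const 4).sqrt hx.ne')
  refine (((hasDerivAt_arsinh_half x).const_mul μ).cosh.div hd hw.ne').congr_deriv ?_
  rw [Real.sq_sqrt hx.le]
  push_cast
  field_simp

/-- For every real parameter `μ`, the function
`y(ζ) = cosh(μ·arsinh(ζ/2))/√(ζ² + 4)` satisfies the Fibonacci-type auxiliary ODE
`(4 + ζ²)·y''(ζ) + 3ζ·y'(ζ) − (μ² − 1)·y(ζ) = 0` for all real `ζ`. -/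
theorem cosh_arsinh_over_sqrt_fib_ode (μ : ℝ) :
    ∀ ζ : ℝ,
      (4 + ζ ^ 2) * deriv (deriv
          (fun s : ℝ => Real.cosh (μ * Real.arsinh (s / 2)) / Real.sqrt (s ^ 2 + 4))) ζ
        + 3 * ζ * deriv
          (fun s : ℝ => Real.cosh (μ * Real.arsinh (s / 2)) / Real.sqrt (s ^ 2 + 4)) ζ
        - (μ ^ 2 - 1) * (Real.cosh (μ * Real.arsinh (ζ / 2)) / Real.sqrt (ζ ^ 2 + 4)) = 0 := by
  intro ζ
  rw [funext fun x => (hasDerivAt_cosh_arsinh_div_sqrt μ x).deriv]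
  have hx : 0 < ζ ^ 2 + 4 := by positivity
  have hw : 0 < √(ζ ^ 2 + 4) := Real.sqrt_pos.2 hx
  have hy := hasDerivAt_cosh_arsinh_div_sqrt μ ζ
  have hs := (((hasDerivAt_arsinh_half ζ).const_mul μ).sinh).const_mul μ
  have h2 := (hs.sub ((hasDerivAt_id' ζ).mul hy)).div ((hasDerivAt_pow 2 ζ).add_const 4) hx.ne'
  erw [h2.deriv]
  simp only [Pi.sub_apply, Pi.mul_apply, Nat.cast_ofNat]
  rw [add_comm 4 (ζ ^ 2)]
  field_simp
  ring
end
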